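/- Fix an integer d ≥ 1, reals 1 ≤ p < ∞ and 1 ≤ v < ∞, and a positive integer K. Let π¹, π² be vectors in the probability simplex indexed by {1,…,2^K}^d, and let μ₁ = Histogram(·|π¹, 2^K) and μ₂ = Histogram(·|π², 2^K) be the corresponding histogram measures on [0,1)^d. For 1 ≤ k ≤ K and S ∈ S_k write πⁱ(S) = Σ_{j : A_{j,2^K} ⊆ S} πⁱ_j (which equals μ_i(S)). Then W_v^v(μ₁, μ₂) ≤ d^{v/p} · ( 2^{−Kv} + Σ_{k=1}^{K} 2^{−(k−1)v} · Σ_{S ∈ S_k} |π¹(S) − π²(S)| ). -/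

import Mathlib

open MeasureTheory Filter
open scoped ENNReal NNReal Classical BigOperators

noncomputable section

/-- ℓ^p distance on ℝ^d. -/
def lpDist (p : ℝ) {d : ℕ} (x y : Fin d → ℝ) : ℝ :=
  (∑ l, |x l - y l| ^ p) ^ (1 / p)

/-- Wasserstein-v distance with respect to the ℓ^p metric, via couplings. -/
def wassersteinLp (p v : ℝ) {d : ℕ} (μ ν : Measure (Fin d → ℝ)) : ℝ :=
  sInf { r : ℝ | ∃ π : Measure ((Fin d → ℝ) × (Fin d → ℝ)),
      IsProbabilityMeasure π ∧ π.map Prod.fst = μ ∧ π.map Prod.snd = ν ∧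
      r = ∫ z, lpDist p z.1 z.2 ^ v ∂π } ^ (1 / v)

/-- The bin A_{j,b} (0-indexed): ∏_l [j_l/b, (j_l+1)/b). -/
def binSet (d b : ℕ) (i : Fin d → Fin b) : Set (Fin d → ℝ) :=
  {x | ∀ l, (i l : ℝ) / b ≤ x l ∧ x l < ((i l : ℝ) + 1) / b}

/-- Histogram probability measure with weights `w`: density Σ_i b^d w_i 1_{A_{i,b}}. -/
def histMeasure (d b : ℕ) (w : (Fin d → Fin b) → ℝ) : Measure (Fin d → ℝ) :=
  volume.withDensity fun x =>
    ENNReal.ofReal (∑ i, (b : ℝ) ^ d * w i * Set.indicator (binSet d b i) 1 x)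

/-- The level-k dyadic partition of [0,1)^d, as a finite set of sets. -/
def dyFinset (d k : ℕ) : Finset (Set (Fin d → ℝ)) :=
  Finset.univ.image fun i : Fin d → Fin (2 ^ k) => binSet d (2 ^ k) i

/-- π(S) = Σ_{j : A_{j,b} ⊆ S} π_j. -/
def weightOfSet (d b : ℕ) (w : (Fin d → Fin b) → ℝ) (S : Set (Fin d → ℝ)) : ℝ :=
  ∑ j ∈ Finset.univ.filter fun j => binSet d b j ⊆ S, w j

section FiniteTransport

variable {ι : Type*} [Fintype ι]

/-- Matching as much mass as possible inside each fibre of `f` leaves an unmatched mass of at most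
the total discrepancy between the fibres. -/
lemma exists_partial_coupling_fibres {β : Type*} [Fintype β] [DecidableEq β] (f : ι → β) (r s : ι → ℝ)
    (hr : ∀ i, 0 ≤ r i) (hs : ∀ i, 0 ≤ s i) :
    ∃ γ : ι → ι → ℝ, (∀ i j, 0 ≤ γ i j) ∧ (∀ i j, f i ≠ f j → γ i j = 0) ∧
      (∀ i, ∑ j, γ i j ≤ r i) ∧ (∀ j, ∑ i, γ i j ≤ s j) ∧
      ∑ i, (r i - ∑ j, γ i j) ≤
        ∑ b, |∑ i with f i = b, r i - ∑ i with f i = b, s i| := by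
  set R : β → ℝ := fun b => ∑ i with f i = b, r i with hR
  set S : β → ℝ := fun b => ∑ i with f i = b, s i with hS
  have hR0 : ∀ b, 0 ≤ R b := fun b => Finset.sum_nonneg fun i _ => hr i
  have hS0 : ∀ b, 0 ≤ S b := fun b => Finset.sum_nonneg fun i _ => hs i
  have hM0 : ∀ b, 0 ≤ max (R b) (S b) := fun b => le_max_of_le_left (hR0 b)
  have hrow : ∀ i, ∑ j, (if f i = f j then r i * s j / max (R (f i)) (S (f i)) else 0) =
      r i * (S (f i) / max (R (f i)) (S (f i))) := by
    intro i
    rw [← Finset.sum_filter, ← Finset.sum_div, ← Finset.mul_sum, mul_div_assoc]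
    simp only [hS, eq_comm]
  have hcol : ∀ j, ∑ i, (if f i = f j then r i * s j / max (R (f i)) (S (f i)) else 0) =
      s j * (R (f j) / max (R (f j)) (S (f j))) := by
    intro j
    rw [← Finset.sum_filter]
    have : ∀ i ∈ Finset.univ.filter (fun i => f i = f j),
        r i * s j / max (R (f i)) (S (f i)) = r i * (s j / max (R (f j)) (S (f j))) := by
      intro i hi
      rw [(Finset.mem_filter.1 hi).2, mul_div_assoc]
    rw [Finset.sum_congr rfl this, ← Finset.sum_mul]
    change R (f j) * _ = _
    ring
  refine ⟨fun i j => if f i = f j then r i * s j / max (R (f i)) (S (f i)) else 0,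
    ?_, ?_, ?_, ?_, ?_⟩
  · intro i j
    dsimp only
    split_ifs
    · exact div_nonneg (mul_nonneg (hr i) (hs j)) (hM0 _)
    · exact le_rfl
  · intro i j h
    simp [h]
  · intro i
    rw [hrow]
    exact mul_le_of_le_one_right (hr i) (div_le_one_of_le₀ (le_max_right _ _) (hM0 _))
  · intro j
    rw [hcol]
    exact mul_le_of_le_one_right (hs j) (div_le_one_of_le₀ (le_max_left _ _) (hM0 _))
  · rw [← Finset.sum_fiberwise Finset.univ f]
    refine Finset.sum_le_sum fun b _ => ?_
    have h1 : ∀ i ∈ Finset.univ.filter (fun i => f i = b),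
        r i - ∑ j, (if f i = f j then r i * s j / max (R (f i)) (S (f i)) else 0) =
          r i * (1 - S b / max (R b) (S b)) := by
      intro i hi
      rw [hrow, (Finset.mem_filter.1 hi).2]
      ring
    rw [Finset.sum_congr rfl h1, ← Finset.sum_mul]
    change R b * _ ≤ |R b - S b|
    rcases (hM0 b).eq_or_lt with h | h
    · have : R b = 0 := le_antisymm (h ▸ le_max_left _ _) (hR0 b)
      simp [this]
    · rcases le_total (R b) (S b) with h' | h'
      · rw [max_eq_right h'] at h ⊢
        rw [div_self h.ne']
        simp
      · rw [max_eq_left h'] at h ⊢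
        rw [mul_sub, mul_div_cancel₀ _ h.ne', mul_one]
        exact le_abs_self _

/-- Multiscale transport of finitely supported masses: if `f 0, f 1, …` induce successively finer
partitions and moving mass inside a cell of `f k` costs at most `c k`, then the transport cost is
controlled by the discrepancies over the cells at each scale. -/
lemma exists_coupling_cost_le {β : ℕ → Type*} [∀ k, Fintype (β k)]
    [∀ k, DecidableEq (β k)] [Subsingleton (β 0)]
    (f : ∀ k, ι → β k) (hf : ∀ k i j, f (k + 1) i = f (k + 1) j → f k i = f k j)
    (C : ι → ι → ℝ) (c : ℕ → ℝ) (hc : ∀ k, 0 ≤ c k) (m : ℕ)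
    (hC : ∀ k ≤ m, ∀ i j, f k i = f k j → C i j ≤ c k) (r s : ι → ℝ)
    (hr : ∀ i, 0 ≤ r i) (hs : ∀ i, 0 ≤ s i) (hrs : ∑ i, r i = ∑ i, s i) :
    ∃ γ : ι → ι → ℝ, (∀ i j, 0 ≤ γ i j) ∧ (∀ i, ∑ j, γ i j = r i) ∧ (∀ j, ∑ i, γ i j = s j) ∧
      ∑ i, ∑ j, γ i j * C i j ≤ c m * ∑ i, r i + ∑ k ∈ Finset.range m,
        c k * ∑ b, |∑ i with f (k + 1) i = b, r i - ∑ i with f (k + 1) i = b, s i| := by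
  have cost_le : ∀ (k : ℕ) (γ : ι → ι → ℝ) (r : ι → ℝ),
      (∀ i j, f k i = f k j → C i j ≤ c k) → (∀ i j, 0 ≤ γ i j) →
      (∀ i j, f k i ≠ f k j → γ i j = 0) → (∀ i, ∑ j, γ i j ≤ r i) →
      ∑ i, ∑ j, γ i j * C i j ≤ c k * ∑ i, r i := by
    intro k γ r hCk h0 hsupp hle
    rw [Finset.mul_sum]
    refine Finset.sum_le_sum fun i _ => ?_
    calc ∑ j, γ i j * C i j ≤ ∑ j, γ i j * c k := by
          refine Finset.sum_le_sum fun j _ => ?_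
          by_cases h : f k i = f k j
          · exact mul_le_mul_of_nonneg_left (hCk i j h) (h0 i j)
          · simp [hsupp i j h]
      _ = c k * ∑ j, γ i j := by rw [← Finset.sum_mul, mul_comm]
      _ ≤ c k * r i := mul_le_mul_of_nonneg_left (hle i) (hc k)
  induction m generalizing r s with
  | zero =>
    obtain ⟨γ, h0, hsupp, hrow, hcol, hres⟩ := exists_partial_coupling_fibres (f 0) r s hr hs
    have hz : ∑ b, |∑ i with f 0 i = b, r i - ∑ i with f 0 i = b, s i| = 0 := by
      refine Finset.sum_eq_zero fun b _ => ?_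
      have : ∀ i, f 0 i = b := fun i => Subsingleton.elim _ _
      simp [this, hrs]
    rw [hz] at hres
    have hsum : ∑ i, (r i - ∑ j, γ i j) = 0 :=
      le_antisymm hres (Finset.sum_nonneg fun i _ => sub_nonneg.2 (hrow i))
    have hrow' : ∀ i, ∑ j, γ i j = r i := fun i => by
      have := (Finset.sum_eq_zero_iff_of_nonneg fun i _ => sub_nonneg.2 (hrow i)).1 hsum i
        (Finset.mem_univ i)
      linarith
    have hsum' : ∑ j, (s j - ∑ i, γ i j) = 0 := by
      rw [Finset.sum_sub_distrib, Finset.sum_comm, ← hrs]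
      simp [hrow']
    have hcol' : ∀ j, ∑ i, γ i j = s j := fun j => by
      have := (Finset.sum_eq_zero_iff_of_nonneg fun i _ => sub_nonneg.2 (hcol i)).1 hsum' j
        (Finset.mem_univ j)
      linarith
    refine ⟨γ, h0, hrow', hcol', ?_⟩
    simpa using cost_le 0 γ r (hC 0 le_rfl) h0 hsupp hrow
  | succ m ih =>
    obtain ⟨γ, h0, hsupp, hrow, hcol, hres⟩ :=
      exists_partial_coupling_fibres (f (m + 1)) r s hr hs
    have hnest : ∀ k ≤ m + 1, ∀ i j, f (m + 1) i = f (m + 1) j → f k i = f k j := by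
      intro k hk i j
      induction hk using Nat.decreasingInduction with
      | self => exact id
      | of_succ k _ ih => exact fun h => hf k i j (ih h)
    have hdiff : ∀ k ≤ m + 1, ∀ b : β k,
        ∑ i with f k i = b, (r i - ∑ j, γ i j) - ∑ j with f k j = b, (s j - ∑ i, γ i j) =
          ∑ i with f k i = b, r i - ∑ i with f k i = b, s i := by
      intro k hk b
      have : ∑ i with f k i = b, ∑ j, γ i j = ∑ j with f k j = b, ∑ i, γ i j := by
        have hpull : ∀ (P : Prop) [Decidable P] (g : ι → ℝ),
            (if P then ∑ j, g j else 0) = ∑ j, if P then g j else 0 := by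
          intro P _ g
          split_ifs <;> simp
        simp only [Finset.sum_filter, hpull]
        rw [Finset.sum_comm]
        refine Finset.sum_congr rfl fun j _ => Finset.sum_congr rfl fun i _ => ?_
        by_cases h : f (m + 1) i = f (m + 1) j
        · rw [hnest k hk i j h]
        · simp [hsupp i j h]
      rw [Finset.sum_sub_distrib, Finset.sum_sub_distrib, this]
      ring
    obtain ⟨γ', h0', hrow', hcol', hcost'⟩ := ih (fun k hk => hC k (hk.trans m.le_succ))
      (fun i => r i - ∑ j, γ i j) (fun j => s j - ∑ i, γ i j)
      (fun i => sub_nonneg.2 (hrow i)) (fun j => sub_nonneg.2 (hcol j)) (by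
        rw [Finset.sum_sub_distrib, Finset.sum_sub_distrib, hrs,
          Finset.sum_comm (f := fun i j => γ i j)])
    refine ⟨fun i j => γ i j + γ' i j, fun i j => add_nonneg (h0 i j) (h0' i j), fun i => ?_,
      fun j => ?_, ?_⟩
    · rw [Finset.sum_add_distrib, hrow' i]
      ring
    · rw [Finset.sum_add_distrib, hcol' j]
      ring
    · have hγ := cost_le (m + 1) γ r (hC _ le_rfl) h0 hsupp hrow
      have hkeep : ∀ k ∈ Finset.range m,
          c k * ∑ b, |∑ i with f (k + 1) i = b, (r i - ∑ j, γ i j) -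
            ∑ j with f (k + 1) j = b, (s j - ∑ i, γ i j)| =
          c k * ∑ b, |∑ i with f (k + 1) i = b, r i - ∑ i with f (k + 1) i = b, s i| := by
        intro k hk
        have hk' : k + 1 ≤ m + 1 := by
          have := Finset.mem_range.1 hk
          omega
        simp only [hdiff (k + 1) hk']
      rw [Finset.sum_congr rfl hkeep] at hcost'
      rw [Finset.sum_range_succ]
      simp only [add_mul, Finset.sum_add_distrib]
      have := mul_le_mul_of_nonneg_left hres (hc m)
      linarith

end FiniteTransport

section UniformOnBins

lemma binSet_eq_pi (d b : ℕ) (i : Fin d → Fin b) :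
    binSet d b i = Set.univ.pi fun l => Set.Ico ((i l : ℝ) / b) (((i l : ℝ) + 1) / b) := by
  ext x
  simp [binSet]

lemma measurableSet_binSet (d b : ℕ) (i : Fin d → Fin b) : MeasurableSet (binSet d b i) := by
  rw [binSet_eq_pi]
  exact MeasurableSet.univ_pi fun l => measurableSet_Ico

lemma volume_binSet (d b : ℕ) (i : Fin d → Fin b) :
    volume (binSet d b i) = ENNReal.ofReal ((1 / b : ℝ) ^ d) := by
  rw [binSet_eq_pi, Real.volume_pi_Ico]
  simp [add_div, ENNReal.ofReal_pow, -inv_pow]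

/-- The uniform probability measure on a bin. -/
def binUniform (d b : ℕ) (i : Fin d → Fin b) : Measure (Fin d → ℝ) :=
  ENNReal.ofReal ((b : ℝ) ^ d) • volume.restrict (binSet d b i)

lemma isProbabilityMeasure_binUniform (d b : ℕ) (hb : b ≠ 0) (i : Fin d → Fin b) :
    IsProbabilityMeasure (binUniform d b i) := by
  constructor
  have hb' : (b : ℝ) ≠ 0 := by exact_mod_cast hb
  rw [binUniform, Measure.smul_apply, Measure.restrict_apply_univ, volume_binSet, smul_eq_mul,
    ← ENNReal.ofReal_mul (by positivity), ← mul_pow, mul_one_div_cancel hb', one_pow,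
    ENNReal.ofReal_one]

lemma ae_binUniform_mem (d b : ℕ) (i : Fin d → Fin b) :
    ∀ᵐ x ∂binUniform d b i, x ∈ binSet d b i :=
  Measure.ae_smul_measure (ae_restrict_mem (measurableSet_binSet d b i)) _

lemma histMeasure_eq_sum (d b : ℕ) (w : (Fin d → Fin b) → ℝ) (hw : ∀ i, 0 ≤ w i) :
    histMeasure d b w = ∑ i, ENNReal.ofReal (w i) • binUniform d b i := by
  have hdens : (fun x => ENNReal.ofReal
        (∑ i, (b : ℝ) ^ d * w i * Set.indicator (binSet d b i) 1 x)) =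
      fun x => ∑ i, Set.indicator (binSet d b i)
        (fun _ => ENNReal.ofReal (w i) * ENNReal.ofReal ((b : ℝ) ^ d)) x := by
    funext x
    rw [ENNReal.ofReal_sum_of_nonneg]
    · refine Finset.sum_congr rfl fun i _ => ?_
      by_cases h : x ∈ binSet d b i
      · simp only [Set.indicator_of_mem h, Pi.one_apply, mul_one]
        rw [← ENNReal.ofReal_mul (hw i), mul_comm]
      · simp [Set.indicator_of_notMem h]
    · intro i _
      exact mul_nonneg (mul_nonneg (by positivity) (hw i))
        (Set.indicator_nonneg (fun _ _ => zero_le_one) _)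
  ext s hs
  rw [histMeasure, hdens, withDensity_apply _ hs, lintegral_finsetSum _ fun i _ =>
    measurable_const.indicator (measurableSet_binSet d b i), Measure.finsetSum_apply]
  refine Finset.sum_congr rfl fun i _ => ?_
  rw [lintegral_indicator_const (measurableSet_binSet d b i),
    Measure.restrict_apply (measurableSet_binSet d b i), binUniform, Measure.smul_apply,
    Measure.smul_apply, Measure.restrict_apply hs, Set.inter_comm, smul_eq_mul, smul_eq_mul,
    mul_assoc]

lemma lpDist_nonneg (p : ℝ) {d : ℕ} (x y : Fin d → ℝ) : 0 ≤ lpDist p x y :=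
  Real.rpow_nonneg (Finset.sum_nonneg fun _ _ => Real.rpow_nonneg (abs_nonneg _) _) _

lemma measurable_lpDist_rpow (p v : ℝ) (d : ℕ) :
    Measurable fun z : (Fin d → ℝ) × (Fin d → ℝ) => lpDist p z.1 z.2 ^ v := by
  unfold lpDist
  fun_prop

lemma lpDist_rpow_le {p v : ℝ} (hp : 0 < p) (hv : 0 ≤ v) {d b : ℕ} {i : Fin d → Fin b}
    {x y : Fin d → ℝ} (hx : x ∈ binSet d b i) (hy : y ∈ binSet d b i) :
    lpDist p x y ^ v ≤ (d : ℝ) ^ (v / p) * (1 / b : ℝ) ^ v := by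
  have hb : (0 : ℝ) ≤ 1 / b := by positivity
  have h1 : ∑ l, |x l - y l| ^ p ≤ d * (1 / b : ℝ) ^ p := by
    calc ∑ l, |x l - y l| ^ p ≤ ∑ _l : Fin d, (1 / b : ℝ) ^ p := by
          refine Finset.sum_le_sum fun l _ => Real.rpow_le_rpow (abs_nonneg _) ?_ hp.le
          have h1 := hx l
          have h2 := hy l
          rw [add_div] at h1 h2
          rw [abs_le]
          constructor <;> linarith
      _ = _ := by simp
  have h2 : lpDist p x y ≤ (d : ℝ) ^ (1 / p) * (1 / b : ℝ) := by
    calc lpDist p x y ≤ (d * (1 / b : ℝ) ^ p) ^ (1 / p) :=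
          Real.rpow_le_rpow (Finset.sum_nonneg fun _ _ => Real.rpow_nonneg (abs_nonneg _) _) h1
            (by positivity)
      _ = _ := by
          rw [Real.mul_rpow (by positivity) (by positivity), ← Real.rpow_mul hb,
            mul_one_div_cancel hp.ne', Real.rpow_one]
  calc lpDist p x y ^ v ≤ ((d : ℝ) ^ (1 / p) * (1 / b : ℝ)) ^ v :=
        Real.rpow_le_rpow (lpDist_nonneg p x y) h2 hv
    _ = _ := by
        rw [Real.mul_rpow (by positivity) hb, ← Real.rpow_mul (by positivity), one_div_mul_eq_div]

lemma binSet_nonempty (d b : ℕ) (i : Fin d → Fin b) : (binSet d b i).Nonempty := by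
  refine ⟨fun l => (i l : ℝ) / b, fun l => ⟨le_rfl, ?_⟩⟩
  have hb : (0 : ℝ) < b := by exact_mod_cast (i l).pos
  exact (div_lt_div_iff_of_pos_right hb).2 (lt_add_one _)

lemma eq_of_mem_binSet {d b : ℕ} {i j : Fin d → Fin b} {x : Fin d → ℝ}
    (hi : x ∈ binSet d b i) (hj : x ∈ binSet d b j) : i = j := by
  funext l
  have hb : (0 : ℝ) < b := by exact_mod_cast (i l).pos
  have h1 := (hi l).1.trans_lt (hj l).2
  have h2 := (hj l).1.trans_lt (hi l).2
  rw [div_lt_div_iff_of_pos_right hb] at h1 h2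
  have h1' : (i l : ℕ) < j l + 1 := by exact_mod_cast h1
  have h2' : (j l : ℕ) < i l + 1 := by exact_mod_cast h2
  exact Fin.ext (by omega)

lemma binSet_injective (d b : ℕ) : Function.Injective (binSet d b) := by
  intro i j h
  obtain ⟨x, hx⟩ := binSet_nonempty d b i
  exact eq_of_mem_binSet hx (h ▸ hx)

end UniformOnBins

section DyadicBins

/-- The level-`k` dyadic cell containing a given level-`K` dyadic bin. -/
def dyadicCell (d K k : ℕ) (i : Fin d → Fin (2 ^ K)) : Fin d → Fin (2 ^ k) :=
  fun l => ⟨i l * 2 ^ k / 2 ^ K, by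
    rw [Nat.div_lt_iff_lt_mul (by positivity), mul_comm]
    exact Nat.mul_lt_mul_of_pos_left (i l).2 (by positivity)⟩

lemma dyadicCell_nested (d K k : ℕ) (i j : Fin d → Fin (2 ^ K))
    (h : dyadicCell d K (k + 1) i = dyadicCell d K (k + 1) j) :
    dyadicCell d K k i = dyadicCell d K k j := by
  have key : ∀ n : ℕ, n * 2 ^ k / 2 ^ K = n * 2 ^ (k + 1) / 2 ^ K / 2 := by
    intro n
    rw [Nat.div_div_eq_div_mul, pow_succ, ← mul_assoc, Nat.mul_div_mul_right _ _ two_pos]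
  funext l
  have := congrArg Fin.val (congrFun h l)
  simp only [dyadicCell] at this
  simp only [dyadicCell, Fin.mk.injEq]
  rw [key, key, this]

lemma succ_mul_two_pow_le {K k : ℕ} (hk : k ≤ K) (n : ℕ) :
    (n + 1) * 2 ^ k ≤ (n * 2 ^ k / 2 ^ K + 1) * 2 ^ K := by
  obtain ⟨m, rfl⟩ := Nat.exists_eq_add_of_le hk
  have h : n * 2 ^ k / 2 ^ (k + m) = n / 2 ^ m := by
    rw [pow_add, mul_comm, Nat.mul_div_mul_left _ _ (by positivity)]
  rw [h, pow_add, mul_comm (2 ^ k), ← mul_assoc]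
  exact Nat.mul_le_mul_right _ (Nat.lt_mul_of_div_lt (Nat.lt_succ_self _) (by positivity))

lemma binSet_subset_dyadicCell {d K k : ℕ} (hk : k ≤ K) (i : Fin d → Fin (2 ^ K)) :
    binSet d (2 ^ K) i ⊆ binSet d (2 ^ k) (dyadicCell d K k i) := by
  intro x hx l
  obtain ⟨h1, h2⟩ := hx l
  have hlo : ((i l * 2 ^ k / 2 ^ K : ℕ) : ℝ) * 2 ^ K ≤ i l * 2 ^ k := by
    exact_mod_cast Nat.div_mul_le_self _ _
  have hhi : ((i l : ℝ) + 1) * 2 ^ k ≤ ((i l * 2 ^ k / 2 ^ K : ℕ) + 1 : ℝ) * 2 ^ K := by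
    have := succ_mul_two_pow_le hk (i l)
    exact_mod_cast this
  simp only [dyadicCell]
  push_cast at h1 h2 ⊢
  constructor
  · refine le_trans ?_ h1
    rw [div_le_div_iff₀ (by positivity) (by positivity)]
    exact_mod_cast hlo
  · refine h2.trans_le ?_
    rw [div_le_div_iff₀ (by positivity) (by positivity)]
    exact_mod_cast hhi

lemma weightOfSet_binSet {d K k : ℕ} (hk : k ≤ K) (w : (Fin d → Fin (2 ^ K)) → ℝ)
    (b : Fin d → Fin (2 ^ k)) :
    weightOfSet d (2 ^ K) w (binSet d (2 ^ k) b) = ∑ i with dyadicCell d K k i = b, w i := by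
  rw [weightOfSet]
  congr 1
  ext i
  simp only [Finset.mem_filter, Finset.mem_univ, true_and]
  constructor
  · intro h
    obtain ⟨x, hx⟩ := binSet_nonempty d _ i
    exact eq_of_mem_binSet (binSet_subset_dyadicCell hk i hx) (h hx)
  · rintro rfl
    exact binSet_subset_dyadicCell hk i

lemma sum_dyFinset {d k : ℕ} (g : Set (Fin d → ℝ) → ℝ) :
    ∑ S ∈ dyFinset d k, g S = ∑ b, g (binSet d (2 ^ k) b) :=
  Finset.sum_image fun _ _ _ _ h => binSet_injective d _ h

end DyadicBins

section HistogramCoupling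

lemma wassersteinLp_rpow_le {p v : ℝ} (hv : 0 < v) {d : ℕ} {μ ν : Measure (Fin d → ℝ)}
    (ρ : Measure ((Fin d → ℝ) × (Fin d → ℝ))) [IsProbabilityMeasure ρ]
    (h1 : ρ.map Prod.fst = μ) (h2 : ρ.map Prod.snd = ν) :
    wassersteinLp p v μ ν ^ v ≤ ∫ z, lpDist p z.1 z.2 ^ v ∂ρ := by
  have hnn : ∀ r ∈ { r : ℝ | ∃ π : Measure ((Fin d → ℝ) × (Fin d → ℝ)),
      IsProbabilityMeasure π ∧ π.map Prod.fst = μ ∧ π.map Prod.snd = ν ∧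
      r = ∫ z, lpDist p z.1 z.2 ^ v ∂π }, 0 ≤ r := by
    rintro r ⟨π, -, -, -, rfl⟩
    exact integral_nonneg fun z => Real.rpow_nonneg (lpDist_nonneg p z.1 z.2) v
  rw [wassersteinLp, ← Real.rpow_mul (Real.sInf_nonneg hnn), one_div_mul_cancel hv.ne',
    Real.rpow_one]
  exact csInf_le ⟨0, hnn⟩ ⟨ρ, inferInstance, h1, h2, rfl⟩

/-- The mean transport cost between two bins under the product of their uniform measures. -/
def binCost (p v : ℝ) (d b : ℕ) (i j : Fin d → Fin b) : ℝ :=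
  ∫ z, lpDist p z.1 z.2 ^ v ∂(binUniform d b i).prod (binUniform d b j)

lemma ae_prod_binUniform_mem (d b : ℕ) (hb : b ≠ 0) (i j : Fin d → Fin b) :
    ∀ᵐ z ∂(binUniform d b i).prod (binUniform d b j), z.1 ∈ binSet d b i ∧ z.2 ∈ binSet d b j := by
  have := isProbabilityMeasure_binUniform d b hb i
  have := isProbabilityMeasure_binUniform d b hb j
  exact (Measure.quasiMeasurePreserving_fst.ae (ae_binUniform_mem d b i)).and
    (Measure.quasiMeasurePreserving_snd.ae (ae_binUniform_mem d b j))

lemma ae_norm_lpDist_rpow_le {p v : ℝ} (hp : 0 < p) (hv : 0 ≤ v) {d K k : ℕ} (hk : k ≤ K)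
    {i j : Fin d → Fin (2 ^ K)} (hij : dyadicCell d K k i = dyadicCell d K k j) :
    ∀ᵐ z ∂(binUniform d (2 ^ K) i).prod (binUniform d (2 ^ K) j),
      ‖lpDist p z.1 z.2 ^ v‖ ≤ (d : ℝ) ^ (v / p) * (1 / (2 ^ k : ℕ) : ℝ) ^ v := by
  filter_upwards [ae_prod_binUniform_mem d (2 ^ K) (by positivity) i j] with z hz
  rw [Real.norm_of_nonneg (Real.rpow_nonneg (lpDist_nonneg p z.1 z.2) v)]
  exact lpDist_rpow_le hp hv (binSet_subset_dyadicCell hk i hz.1)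
    (hij ▸ binSet_subset_dyadicCell hk j hz.2)

lemma dyadicCell_zero_eq {d K : ℕ} (i j : Fin d → Fin (2 ^ K)) :
    dyadicCell d K 0 i = dyadicCell d K 0 j :=
  funext fun _ => Subsingleton.elim (α := Fin 1) _ _

lemma binCost_le {p v : ℝ} (hp : 0 < p) (hv : 0 ≤ v) {d K k : ℕ} (hk : k ≤ K)
    {i j : Fin d → Fin (2 ^ K)} (hij : dyadicCell d K k i = dyadicCell d K k j) :
    binCost p v d (2 ^ K) i j ≤ (d : ℝ) ^ (v / p) * (1 / (2 ^ k : ℕ) : ℝ) ^ v := by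
  have := isProbabilityMeasure_binUniform d (2 ^ K) (by positivity) i
  have := isProbabilityMeasure_binUniform d (2 ^ K) (by positivity) j
  have h := norm_integral_le_of_norm_le_const (ae_norm_lpDist_rpow_le hp hv hk hij)
  rw [probReal_univ, mul_one] at h
  exact (le_abs_self _).trans h

lemma wassersteinLp_histMeasure_rpow_le {p v : ℝ} (hp : 0 < p) (hv : 0 < v) {d K : ℕ}
    {w₁ w₂ : (Fin d → Fin (2 ^ K)) → ℝ} (hw : ∑ i, w₁ i = 1)
    (γ : (Fin d → Fin (2 ^ K)) → (Fin d → Fin (2 ^ K)) → ℝ) (h0 : ∀ i j, 0 ≤ γ i j)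
    (h1 : ∀ i, ∑ j, γ i j = w₁ i) (h2 : ∀ j, ∑ i, γ i j = w₂ j) :
    wassersteinLp p v (histMeasure d (2 ^ K) w₁) (histMeasure d (2 ^ K) w₂) ^ v ≤
      ∑ i, ∑ j, γ i j * binCost p v d (2 ^ K) i j := by
  have hU := isProbabilityMeasure_binUniform d (2 ^ K) (by positivity)
  set ρ : Measure ((Fin d → ℝ) × (Fin d → ℝ)) := ∑ i, ∑ j, ENNReal.ofReal (γ i j) •
    (binUniform d (2 ^ K) i).prod (binUniform d (2 ^ K) j) with hρ
  have hfst : ρ.map Prod.fst = histMeasure d (2 ^ K) w₁ := by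
    rw [histMeasure_eq_sum _ _ _ fun i => h1 i ▸ Finset.sum_nonneg fun j _ => h0 i j]
    ext s hs
    rw [Measure.map_apply measurable_fst hs]
    simp only [hρ, Measure.finsetSum_apply, Measure.smul_apply, smul_eq_mul, ← h1]
    simp only [← Measure.map_apply measurable_fst hs, Measure.map_fst_prod, measure_univ, one_smul]
    refine Finset.sum_congr rfl fun i _ => ?_
    rw [← Finset.sum_mul, ENNReal.ofReal_sum_of_nonneg fun j _ => h0 i j]
  have hsnd : ρ.map Prod.snd = histMeasure d (2 ^ K) w₂ := by
    rw [histMeasure_eq_sum _ _ _ fun j => h2 j ▸ Finset.sum_nonneg fun i _ => h0 i j]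
    ext s hs
    rw [Measure.map_apply measurable_snd hs]
    simp only [hρ, Measure.finsetSum_apply, Measure.smul_apply, smul_eq_mul, ← h2]
    simp only [← Measure.map_apply measurable_snd hs, Measure.map_snd_prod, measure_univ, one_smul]
    rw [Finset.sum_comm]
    refine Finset.sum_congr rfl fun j _ => ?_
    rw [← Finset.sum_mul, ENNReal.ofReal_sum_of_nonneg fun i _ => h0 i j]
  have hprob : IsProbabilityMeasure ρ := by
    constructor
    simp only [hρ, Measure.finsetSum_apply, Measure.smul_apply, measure_univ, smul_eq_mul, mul_one]
    simp only [← ENNReal.ofReal_sum_of_nonneg fun j _ => h0 _ j, h1]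
    rw [← ENNReal.ofReal_sum_of_nonneg fun i _ => h1 i ▸ Finset.sum_nonneg fun j _ => h0 i j, hw,
      ENNReal.ofReal_one]
  have hint : ∀ i j, Integrable (fun z : (Fin d → ℝ) × (Fin d → ℝ) => lpDist p z.1 z.2 ^ v)
      (ENNReal.ofReal (γ i j) • (binUniform d (2 ^ K) i).prod (binUniform d (2 ^ K) j)) :=
    fun i j => (Integrable.of_bound (measurable_lpDist_rpow p v d).aestronglyMeasurable _
      (ae_norm_lpDist_rpow_le hp hv.le K.zero_le (dyadicCell_zero_eq i j))).smul_measure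
        ENNReal.ofReal_ne_top
  refine (wassersteinLp_rpow_le hv ρ hfst hsnd).trans_eq ?_
  rw [hρ, integral_finsetSum_measure fun i _ => integrable_finsetSum_measure.2 fun j _ => hint i j]
  refine Finset.sum_congr rfl fun i _ => ?_
  rw [integral_finsetSum_measure fun j _ => hint i j]
  refine Finset.sum_congr rfl fun j _ => ?_
  rw [integral_smul_measure, ENNReal.toReal_ofReal (h0 i j), smul_eq_mul, binCost]

end HistogramCoupling

/-- multiresolution bound for the Wasserstein distance between two dyadic
histograms with 2^K bins per axis:
W_v^v(μ₁,μ₂) ≤ d^{v/p}(2^{−Kv} + Σ_{k=1}^K 2^{−(k−1)v} Σ_{S∈S_k} |π¹(S) − π²(S)|). -/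
theorem histogram_multiresolution_bound
    (d : ℕ) (hd : 1 ≤ d) (p v : ℝ) (hp : 1 ≤ p) (hv : 1 ≤ v) (K : ℕ) (hK : 1 ≤ K)
    (π₁ π₂ : (Fin d → Fin (2 ^ K)) → ℝ)
    (hπ₁ : (∀ j, 0 ≤ π₁ j) ∧ ∑ j, π₁ j = 1)
    (hπ₂ : (∀ j, 0 ≤ π₂ j) ∧ ∑ j, π₂ j = 1) :
    wassersteinLp p v (histMeasure d (2 ^ K) π₁) (histMeasure d (2 ^ K) π₂) ^ v ≤
      (d : ℝ) ^ (v / p) *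
        ((2 : ℝ) ^ (-((K : ℝ) * v)) +
          ∑ k ∈ Finset.Icc 1 K, (2 : ℝ) ^ (-(((k : ℝ) - 1) * v)) *
            ∑ S ∈ dyFinset d k,
              |weightOfSet d (2 ^ K) π₁ S - weightOfSet d (2 ^ K) π₂ S|) := by
  have hp0 : 0 < p := one_pos.trans_le hp
  have hv0 : 0 < v := one_pos.trans_le hv
  have : Subsingleton (Fin d → Fin (2 ^ 0)) :=
    ⟨fun a b => funext fun l => Subsingleton.elim (α := Fin 1) (a l) (b l)⟩
  obtain ⟨γ, h0, h1, h2, hcost⟩ := exists_coupling_cost_le (fun k => dyadicCell d K k)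
    (dyadicCell_nested d K) (binCost p v d (2 ^ K))
    (fun k => (d : ℝ) ^ (v / p) * (1 / (2 ^ k : ℕ) : ℝ) ^ v) (fun k => by positivity) K
    (fun k hk i j h => binCost_le hp0 hv0.le hk h) π₁ π₂ hπ₁.1 hπ₂.1 (hπ₁.2.trans hπ₂.2.symm)
  refine (wassersteinLp_histMeasure_rpow_le hp0 hv0 hπ₁.2 γ h0 h1 h2).trans
    (hcost.trans_eq ?_)
  have hscale : ∀ k : ℕ, (1 / (2 ^ k : ℕ) : ℝ) ^ v = (2 : ℝ) ^ (-((k : ℝ) * v)) := by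
    intro k
    rw [neg_mul_eq_neg_mul, Real.rpow_mul two_pos.le, Real.rpow_neg two_pos.le,
      Real.rpow_natCast, one_div]
    push_cast
    rfl
  rw [hπ₁.2, mul_one, mul_add, Finset.mul_sum]
  congr 1
  · rw [hscale]
  · rw [← Finset.Ico_add_one_right_eq_Icc, Finset.sum_Ico_eq_sum_range, Nat.add_sub_cancel]
    refine Finset.sum_congr rfl fun k hk => ?_
    have hk' : k + 1 ≤ K := Finset.mem_range.1 hk
    rw [add_comm 1 k, sum_dyFinset, hscale, mul_assoc]
    simp only [weightOfSet_binSet hk', Nat.cast_add, Nat.cast_one, add_sub_cancel_right]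

end
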